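/- Let f : [0,1]^d → ℝ be continuously differentiable, fix i ∈ {1,…,d}, and assume the total variance D > 0. Then S_i^tot ≤ ν_i / (π² D) (upper bound UB1). -/

import Mathlib

open MeasureTheory Real

noncomputable section

/-- The unit cube `[0,1]^d` in `ℝ^d`. -/
def unitCube (d : ℕ) : Set (Fin d → ℝ) := Set.Icc 0 1

/-- The partial derivative `∂f/∂x_i` at the point `x`. -/
def pderivI {d : ℕ} (f : (Fin d → ℝ) → ℝ) (i : Fin d) (x : Fin d → ℝ) : ℝ :=
  deriv (fun t : ℝ => f (Function.update x i t)) (x i)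

/-- `u_i(x) = f(x) - ∫₀¹ f(x₁,…,x_{i-1},t,x_{i+1},…,x_d) dt`, the sum of all ANOVA
terms of `f` depending on `x_i`. -/
def uComp {d : ℕ} (f : (Fin d → ℝ) → ℝ) (i : Fin d) (x : Fin d → ℝ) : ℝ :=
  f x - ∫ t in (0:ℝ)..1, f (Function.update x i t)

/-- The total variance `D = ∫ f² dx − (∫ f dx)²` over the unit cube. -/
def totVar {d : ℕ} (f : (Fin d → ℝ) → ℝ) : ℝ :=
  (∫ x in unitCube d, (f x) ^ 2) - (∫ x in unitCube d, f x) ^ 2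

/-- The total partial variance `D_i^tot = ∫ u_i² dx`. -/
def DTot {d : ℕ} (f : (Fin d → ℝ) → ℝ) (i : Fin d) : ℝ :=
  ∫ x in unitCube d, (uComp f i x) ^ 2

/-- The total Sobol' sensitivity index `S_i^tot = D_i^tot / D`. -/
def STot {d : ℕ} (f : (Fin d → ℝ) → ℝ) (i : Fin d) : ℝ :=
  DTot f i / totVar f

/-- The DGSM `ν_i = ∫ (∂f/∂x_i)² dx`. -/
def nuDGSM {d : ℕ} (f : (Fin d → ℝ) → ℝ) (i : Fin d) : ℝ :=
  ∫ x in unitCube d, (pderivI f i x) ^ 2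

/-- The DGSM `w_i^{(m)} = ∫ x_i^m (∂f/∂x_i) dx`. -/
def wDGSM {d : ℕ} (f : (Fin d → ℝ) → ℝ) (i : Fin d) (m : ℝ) : ℝ :=
  ∫ x in unitCube d, (x i) ^ m * pderivI f i x

/-- The DGSM `ς_i = (1/2) ∫ x_i (1 - x_i) (∂f/∂x_i)² dx`. -/
def sigmaDGSM {d : ℕ} (f : (Fin d → ℝ) → ℝ) (i : Fin d) : ℝ :=
  (1 / 2) * ∫ x in unitCube d, x i * (1 - x i) * (pderivI f i x) ^ 2

/-- One-dimensional estimate with a constant below the sharp one. -/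
lemma poincare_aux (g g' : ℝ → ℝ) (hg : ∀ x, HasDerivAt g (g' x) x) (hg' : Continuous g')
    (h0 : ∫ t in (0:ℝ)..1, g t = 0) (l : ℝ) (hl0 : 0 < l) (hl : l < π) :
    l ^ 2 * ∫ t in (0:ℝ)..1, (g t) ^ 2 ≤ ∫ t in (0:ℝ)..1, (g' t) ^ 2 := by
  have hgc : Continuous g := continuous_iff_continuousAt.2 fun x => (hg x).continuousAt
  set G : ℝ → ℝ := fun x => ∫ t in (0:ℝ)..x, g t with hG
  have hGd : ∀ x, HasDerivAt G (g x) x := fun x => hgc.integral_hasStrictDerivAt 0 x |>.hasDerivAt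
  have hGc : Continuous G := continuous_iff_continuousAt.2 fun x => (hGd x).continuousAt
  have hG0 : G 0 = 0 := by simp [hG]
  have hG1 : G 1 = 0 := h0
  set T : ℝ → ℝ := fun x => Real.tan (l * (x - 1 / 2)) with hT
  have hcos : ∀ x ∈ Set.Icc (0:ℝ) 1, Real.cos (l * (x - 1 / 2)) ≠ 0 := by
    intro x hx
    refine (Real.cos_pos_of_mem_Ioo ⟨?_, ?_⟩).ne'
    · nlinarith [hx.1, hx.2]
    · nlinarith [hx.1, hx.2]
  have hTd : ∀ x ∈ Set.Icc (0:ℝ) 1, HasDerivAt T (l * (1 + T x ^ 2)) x := by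
    intro x hx
    have h1 : HasDerivAt (fun x : ℝ => l * (x - 1 / 2)) l x := by
      have h := ((hasDerivAt_id x).sub_const (1 / 2)).const_mul l
      rw [mul_one] at h
      exact h
    have h2 := (Real.hasDerivAt_tan (hcos x hx)).comp x h1
    have h3 := Real.inv_one_add_tan_sq (hcos x hx)
    have h4 : 1 / Real.cos (l * (x - 1 / 2)) ^ 2 * l = l * (1 + T x ^ 2) := by
      rw [← h3, one_div, inv_inv, mul_comm]
    rw [h4] at h2
    exact h2
  have hTc : ContinuousOn T (Set.Icc 0 1) := fun x hx => (hTd x hx).continuousAt.continuousWithinAt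
  set F' : ℝ → ℝ := fun x => -2 * l ^ 2 * (g x * g x + G x * g' x)
    - l ^ 3 * ((l * (1 + T x ^ 2)) * G x ^ 2 + T x * (2 * G x * g x)) with hF'
  have hFd : ∀ x ∈ Set.uIcc (0:ℝ) 1, HasDerivAt
      (fun x => -2 * l ^ 2 * (G x * g x) - l ^ 3 * (T x * G x ^ 2)) (F' x) x := by
    intro x hx
    rw [Set.uIcc_of_le zero_le_one] at hx
    have := (((hGd x).mul (hg x)).const_mul (-2 * l ^ 2)).sub
      (((hTd x hx).mul ((hGd x).pow 2)).const_mul (l ^ 3))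
    refine this.congr_deriv ?_
    simp [hF']
  have hF'c : ContinuousOn F' (Set.uIcc 0 1) := by
    rw [Set.uIcc_of_le zero_le_one]
    have := hgc.continuousOn (s := Set.Icc 0 1)
    have := hg'.continuousOn (s := Set.Icc 0 1)
    have := hGc.continuousOn (s := Set.Icc 0 1)
    fun_prop
  have hFI := hF'c.intervalIntegrable (μ := volume)
  have hint := intervalIntegral.integral_eq_sub_of_hasDerivAt hFd hFI
  simp only [hG0, hG1] at hint
  have i1 : IntervalIntegrable (fun t => (g' t) ^ 2) volume 0 1 :=
    (hg'.pow 2).intervalIntegrable _ _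
  have i2 : IntervalIntegrable (fun t => l ^ 2 * (g t) ^ 2) volume 0 1 :=
    ((hgc.pow 2).const_mul _).intervalIntegrable _ _
  have key : ∫ t in (0:ℝ)..1, F' t ≤ ∫ t in (0:ℝ)..1, ((g' t) ^ 2 - l ^ 2 * (g t) ^ 2) := by
    refine intervalIntegral.integral_mono_on zero_le_one hFI (i1.sub i2) fun x _ => ?_
    have e : (g' x) ^ 2 - l ^ 2 * (g x) ^ 2 - F' x
        = (g' x + l ^ 2 * G x) ^ 2 + l ^ 2 * (g x + l * T x * G x) ^ 2 := by
      simp only [hF']; ring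
    have : 0 ≤ (g' x + l ^ 2 * G x) ^ 2 + l ^ 2 * (g x + l * T x * G x) ^ 2 := by positivity
    linarith
  rw [intervalIntegral.integral_sub i1 i2, intervalIntegral.integral_const_mul, hint] at key
  linarith

/-- Sharp one-dimensional Poincare inequality for mean-zero functions. -/
lemma poincare_zero (g g' : ℝ → ℝ) (hg : ∀ x, HasDerivAt g (g' x) x) (hg' : Continuous g')
    (h0 : ∫ t in (0:ℝ)..1, g t = 0) :
    π ^ 2 * ∫ t in (0:ℝ)..1, (g t) ^ 2 ≤ ∫ t in (0:ℝ)..1, (g' t) ^ 2 := by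
  have ht : Filter.Tendsto (fun l : ℝ => l ^ 2 * ∫ t in (0:ℝ)..1, (g t) ^ 2)
      (nhdsWithin π (Set.Iio π)) (nhds (π ^ 2 * ∫ t in (0:ℝ)..1, (g t) ^ 2)) := by
    have : Continuous (fun l : ℝ => l ^ 2 * ∫ t in (0:ℝ)..1, (g t) ^ 2) := by fun_prop
    exact (this.tendsto π).mono_left nhdsWithin_le_nhds
  refine le_of_tendsto ht ?_
  filter_upwards [Ioo_mem_nhdsLT Real.pi_pos] with l hl
  exact poincare_aux g g' hg hg' h0 l hl.1 hl.2

lemma cube_integrable {d : ℕ} {h : (Fin d → ℝ) → ℝ} (hh : Continuous h) :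
    Integrable h (Measure.pi fun _ : Fin d => (volume : Measure ℝ).restrict (Set.Icc 0 1)) := by
  rw [← Measure.restrict_pi_pi]
  exact hh.continuousOn.integrableOn_compact (isCompact_univ_pi fun _ => isCompact_Icc)

lemma cube_integral {d : ℕ} (h : (Fin d → ℝ) → ℝ) :
    ∫ x in unitCube d, h x =
      ∫ x, h x ∂(Measure.pi fun _ : Fin d => (volume : Measure ℝ).restrict (Set.Icc 0 1)) := by
  rw [← Measure.restrict_pi_pi, ← volume_pi]
  congr 2
  ext x
  simp [unitCube, Set.mem_Icc, Pi.le_def]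

lemma cube_mono {n : ℕ} (i : Fin (n + 1)) (a b : (Fin (n + 1) → ℝ) → ℝ) (ha : Continuous a)
    (hb : Continuous b)
    (hab : ∀ y : Fin n → ℝ, ∫ t in (0:ℝ)..1, a (i.insertNth t y)
      ≤ ∫ t in (0:ℝ)..1, b (i.insertNth t y)) :
    ∫ x in unitCube (n + 1), a x ≤ ∫ x in unitCube (n + 1), b x := by
  rw [cube_integral, cube_integral]
  have mp := (measurePreserving_piFinSuccAbove
    (fun _ : Fin (n + 1) => (volume : Measure ℝ).restrict (Set.Icc 0 1)) i).symm
  have hia := (mp.integrable_comp_emb (MeasurableEquiv.measurableEmbedding _)).2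
    (cube_integrable ha)
  have hib := (mp.integrable_comp_emb (MeasurableEquiv.measurableEmbedding _)).2
    (cube_integrable hb)
  rw [← mp.integral_comp (MeasurableEquiv.measurableEmbedding _),
    ← mp.integral_comp (MeasurableEquiv.measurableEmbedding _)]
  refine (integral_prod_symm _ hia).trans_le (le_trans ?_ (integral_prod_symm _ hib).ge)
  refine integral_mono hia.integral_prod_right hib.integral_prod_right fun y => ?_
  have := hab y
  rw [intervalIntegral.integral_of_le zero_le_one, intervalIntegral.integral_of_le zero_le_one,
    ← integral_Icc_eq_integral_Ioc, ← integral_Icc_eq_integral_Ioc] at this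
  exact this

lemma hasDerivAt_line {d : ℕ} (f : (Fin d → ℝ) → ℝ) (hf : ContDiff ℝ 1 f) (i : Fin d)
    (x : Fin d → ℝ) (t : ℝ) :
    HasDerivAt (fun t : ℝ => f (Function.update x i t))
      (fderiv ℝ f (Function.update x i t) (Pi.single i 1)) t := by
  have h1 := (hf.differentiable one_ne_zero (Function.update x i t)).hasFDerivAt
  exact h1.comp_hasDerivAt t (hasDerivAt_update x i t)

lemma pderivI_eq {d : ℕ} (f : (Fin d → ℝ) → ℝ) (hf : ContDiff ℝ 1 f) (i : Fin d) :
    pderivI f i = fun x => fderiv ℝ f x (Pi.single i 1) := by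
  funext x
  rw [pderivI, (hasDerivAt_line f hf i x (x i)).deriv, Function.update_eq_self]

lemma DTot_le {d : ℕ} (f : (Fin d → ℝ) → ℝ) (hf : ContDiff ℝ 1 f) (i : Fin d) :
    π ^ 2 * DTot f i ≤ nuDGSM f i := by
  obtain _ | n := d
  · exact i.elim0
  have hfc := hf.continuous
  have hpc : Continuous (fun x => fderiv ℝ f x (Pi.single i 1)) :=
    (hf.continuous_fderiv one_ne_zero).clm_apply continuous_const
  have huc : Continuous (uComp f i) := by
    unfold uComp
    refine hfc.sub ?_
    apply intervalIntegral.continuous_parametric_intervalIntegral_of_continuous'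
    exact hfc.comp (continuous_fst.update i continuous_snd)
  unfold DTot nuDGSM
  rw [pderivI_eq f hf i, ← integral_const_mul]
  refine cube_mono i _ _ ((huc.pow 2).const_mul _) (hpc.pow 2) fun y => ?_
  have hup : ∀ s t : ℝ, Function.update (i.insertNth (α := fun _ => ℝ) s y) i t
      = i.insertNth (α := fun _ => ℝ) t y := by
    intro s t; simp
  have hline : ∀ t, HasDerivAt (fun t : ℝ => f (i.insertNth (α := fun _ => ℝ) t y))
      (fderiv ℝ f (i.insertNth (α := fun _ => ℝ) t y) (Pi.single i 1)) t := by
    intro t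
    have := hasDerivAt_line f hf i (i.insertNth (α := fun _ => ℝ) 0 y) t
    simpa only [hup] using this
  have hins : Continuous (fun t : ℝ => i.insertNth (α := fun _ => ℝ) t y) := by
    have : Continuous (fun t : ℝ => Function.update (i.insertNth (α := fun _ => ℝ) 0 y) i t) :=
      continuous_const.update i continuous_id
    simpa only [hup] using this
  set c := ∫ t in (0:ℝ)..1, f (i.insertNth (α := fun _ => ℝ) t y) with hc
  have hu : ∀ t, uComp f i (i.insertNth (α := fun _ => ℝ) t y)
      = f (i.insertNth (α := fun _ => ℝ) t y) - c := by
    intro t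
    simp only [uComp, hup, hc]
  rw [intervalIntegral.integral_const_mul]
  simp only [hu]
  refine poincare_zero (fun t => f (i.insertNth (α := fun _ => ℝ) t y) - c) _
    (fun t => (hline t).sub_const c) (hpc.comp hins) ?_
  have hi : IntervalIntegrable (fun t : ℝ => f (i.insertNth (α := fun _ => ℝ) t y)) volume 0 1 :=
    (hfc.comp hins).intervalIntegrable _ _
  rw [intervalIntegral.integral_sub hi (by simp)]
  simp [hc]

/-- **Theorem 4 (upper bound UB1).** For `f` continuously differentiable on the unit cube
with `D > 0`, the total Sobol' index satisfies `S_i^tot ≤ ν_i / (π² D)`. -/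
theorem dgsm_upper_bound_UB1 (d : ℕ) (f : (Fin d → ℝ) → ℝ) (hf : ContDiff ℝ 1 f)
    (i : Fin d) (hD : 0 < totVar f) :
    STot f i ≤ nuDGSM f i / (π ^ 2 * totVar f) := by
  have h := DTot_le f hf i
  unfold STot
  rw [div_le_div_iff₀ hD (by positivity)]
  nlinarith [mul_le_mul_of_nonneg_right h hD.le]
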